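/- arXiv:1612.06800 — 4 statements merged into one kernel-verified Lean document; each statement's English description precedes it below -/
import Mathlib

section
/- Shortening Lemma, squared identity: with the data below, the reduced family d' is again a matrix factorization of ℓ on the remaining indices; precisely, for all i, j ∈ ι \ {a, b}, the sum ∑_{k ∈ ι \ {a,b}} (d' i k) ∘ (d' k j) equals ℓ • id_{P i} if i = j, and equals 0 if i ≠ j. -/
/-- Eliminating the invertible entry `d b a` from a family of linear maps leaves the `(i, j)` entry
of its square unchanged, provided the entries `(b, j)`, `(i, a)` and `(b, a)` of the square
vanish. -/
theorem sum_reduced_apply_eq_sum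
    {A : Type*} [Ring A] {ι : Type*} [Fintype ι] [DecidableEq ι]
    {P : ι → Type*} [∀ i, AddCommGroup (P i)] [∀ i, Module A (P i)]
    (d : ∀ i j, P j →ₗ[A] P i) {a b : ι} (φinv : P b →ₗ[A] P a)
    (hφ₁ : ∀ x : P a, φinv (d b a x) = x) (hφ₂ : ∀ y : P b, d b a (φinv y) = y)
    (d' : ∀ i j, P j →ₗ[A] P i)
    (hd' : ∀ i j, d' i j = d i j - (d i a) ∘ₗ φinv ∘ₗ (d b j)) {i j : ι}
    (hbj : ∀ x : P j, ∑ k, d b k (d k j x) = 0)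
    (hia : ∀ x : P a, ∑ k, d i k (d k a x) = 0)
    (hba : ∀ x : P a, ∑ k, d b k (d k a x) = 0) (x : P j) :
    ∑ k ∈ Finset.univ.filter (fun k => k ≠ a ∧ k ≠ b), d' i k (d' k j x) =
      ∑ k, d i k (d k j x) := by
  have h_univ : ∑ k ∈ Finset.univ.filter (fun k => k ≠ a ∧ k ≠ b), d' i k (d' k j x) =
      ∑ k, d' i k (d' k j x) := by
    refine Finset.sum_subset (Finset.filter_subset _ _) fun k _ hk => ?_
    have hk : k = a ∨ k = b := by
      by_contra! h
      exact hk (by simpa using h)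
    rcases hk with rfl | rfl
    · simp [hd' i, hφ₁]
    · simp [hd' _ j, hφ₂]
  rw [h_univ]
  simp only [hd', LinearMap.sub_apply, LinearMap.comp_apply, map_sub, Finset.sum_sub_distrib,
    ← map_sum, hbj, hia, hba, map_zero, sub_zero]


/-- Shortening Lemma, squared identity: the reduced family `d'` is again a
matrix factorization of `ℓ` on the indices different from `a` and `b`. -/
theorem shortening_lemma_squared
    {A : Type*} [Ring A] {ℓ : A} (hℓ : ℓ ∈ Set.center A)
    {ι : Type*} [Fintype ι] [DecidableEq ι]
    {P : ι → Type*} [∀ i, AddCommGroup (P i)] [∀ i, Module A (P i)]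
    (d : ∀ i j, P j →ₗ[A] P i)
    (hdiag : ∀ i, d i i = 0)
    (hoff : ∀ i j, i ≠ j → ∀ x : P j, ∑ k, d i k (d k j x) = 0)
    (hsq : ∀ i (x : P i), ∑ k, d i k (d k i x) = ℓ • x)
    (a b : ι) (hab : a ≠ b)
    (φinv : P b →ₗ[A] P a)
    (hφ₁ : ∀ x : P a, φinv (d b a x) = x)
    (hφ₂ : ∀ y : P b, d b a (φinv y) = y)
    (d' : ∀ i j, P j →ₗ[A] P i)
    (hd' : ∀ i j, d' i j = d i j - (d i a) ∘ₗ φinv ∘ₗ (d b j)) :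
    (∀ i, i ≠ a → i ≠ b → ∀ x : P i,
        ∑ k ∈ Finset.univ.filter (fun k => k ≠ a ∧ k ≠ b), d' i k (d' k i x) = ℓ • x) ∧
    (∀ i j, i ≠ a → i ≠ b → j ≠ a → j ≠ b → i ≠ j → ∀ x : P j,
        ∑ k ∈ Finset.univ.filter (fun k => k ≠ a ∧ k ≠ b), d' i k (d' k j x) = 0) := by
  refine ⟨fun i hia hib x => ?_, fun i j hia _ _ hjb hij x => ?_⟩
  · rw [sum_reduced_apply_eq_sum d φinv hφ₁ hφ₂ d' hd' (hoff b i hib.symm) (hoff i a hia)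
      (hoff b a hab.symm), hsq]
  · rw [sum_reduced_apply_eq_sum d φinv hφ₁ hφ₂ d' hd' (hoff b j hjb.symm) (hoff i a hia)
      (hoff b a hab.symm), hoff i j hij]
end

section
/- Shortening Lemma, ψ is a chain map: with the data below, the family ψ intertwines d and the reduced maps d'; precisely, for every i ∈ ι and every k ∈ ι \ {a, b}, one has ∑_{j ∈ ι} (d i j) ∘ (ψ j k) = ∑_{j ∈ ι \ {a,b}} (ψ i j) ∘ (d' j k). -/
/-- A finite sum splits off the terms at two distinct indices. -/
theorem sum_eq_add_add_sum_filter_ne_and_ne {ι M : Type*} [Fintype ι] [DecidableEq ι]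
    [AddCommMonoid M] {a b : ι} (hab : a ≠ b) (f : ι → M) :
    ∑ j, f j = f a + f b + ∑ j ∈ Finset.univ.filter (fun j => j ≠ a ∧ j ≠ b), f j := by
  rw [← Finset.sum_pair hab, ← Finset.sum_filter_add_sum_filter_not Finset.univ
    (fun j => j = a ∨ j = b)]
  congr 2 <;> ext j <;> simp

/-- Shortening Lemma, `ψ` is a chain map: the family `ψ` intertwines `d` and the
reduced maps `d'`. -/
theorem shortening_lemma_psi_chain_map
    {A : Type*} [Ring A] {ℓ : A} (hℓ : ℓ ∈ Set.center A)
    {ι : Type*} [Fintype ι] [DecidableEq ι]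
    {P : ι → Type*} [∀ i, AddCommGroup (P i)] [∀ i, Module A (P i)]
    (d : ∀ i j, P j →ₗ[A] P i)
    (hdiag : ∀ i, d i i = 0)
    (hoff : ∀ i j, i ≠ j → ∀ x : P j, ∑ k, d i k (d k j x) = 0)
    (hsq : ∀ i (x : P i), ∑ k, d i k (d k i x) = ℓ • x)
    (a b : ι) (hab : a ≠ b)
    (φinv : P b →ₗ[A] P a)
    (hφ₁ : ∀ x : P a, φinv (d b a x) = x)
    (hφ₂ : ∀ y : P b, d b a (φinv y) = y)
    (d' : ∀ i j, P j →ₗ[A] P i)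
    (hd' : ∀ i j, d' i j = d i j - (d i a) ∘ₗ φinv ∘ₗ (d b j))
    (ψ : ∀ j k, P k →ₗ[A] P j)
    (hψdiag : ∀ k, k ≠ a → k ≠ b → ψ k k = LinearMap.id)
    (hψzero : ∀ j k, k ≠ a → k ≠ b → j ≠ a → j ≠ b → j ≠ k → ψ j k = 0)
    (hψa : ∀ k, k ≠ a → k ≠ b → ψ a k = -(φinv ∘ₗ d b k))
    (hψb : ∀ k, k ≠ a → k ≠ b → ψ b k = 0) :
    ∀ i k, k ≠ a → k ≠ b → ∀ x : P k,
      ∑ j, d i j (ψ j k x) =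
        ∑ j ∈ Finset.univ.filter (fun j => j ≠ a ∧ j ≠ b), ψ i j (d' j k x) := by
  intro i k hka hkb x
  have hk : k ∈ Finset.univ.filter (fun j => j ≠ a ∧ j ≠ b) := by simp [hka, hkb]
  have hlhs : ∑ j, d i j (ψ j k x) = d' i k x := by
    rw [sum_eq_add_add_sum_filter_ne_and_ne hab, Finset.sum_eq_single_of_mem k hk]
    · simp [hψa k hka hkb, hψb k hka hkb, hψdiag k hka hkb, hd', sub_eq_neg_add]
    · intro j hj hjk
      obtain ⟨hja, hjb⟩ := (Finset.mem_filter.mp hj).2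
      simp [hψzero j k hka hkb hja hjb hjk]
  rw [hlhs]
  by_cases hia : i = a
  · subst hia
    have hsum (c : ι) (hc : b ≠ c) (y : P c) :
        ∑ j ∈ Finset.univ.filter (fun j => j ≠ i ∧ j ≠ b), d b j (d j c y) =
          -d b i (d i c y) := by
      have h := hoff b c hc y
      rw [sum_eq_add_add_sum_filter_ne_and_ne hab] at h
      simpa [hdiag] using eq_neg_of_add_eq_zero_right h
    have hrhs : ∀ j ∈ Finset.univ.filter (fun j => j ≠ i ∧ j ≠ b), ψ i j (d' j k x) =
        -φinv (d b j (d j k x) - d b j (d j i (φinv (d b k x)))) := by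
      intro j hj
      obtain ⟨hja, hjb⟩ := (Finset.mem_filter.mp hj).2
      simp [hψa j hja hjb, hd']
    rw [Finset.sum_congr rfl hrhs, Finset.sum_neg_distrib, ← map_sum, Finset.sum_sub_distrib,
      hsum k hkb.symm, hsum i hab.symm]
    simp [hdiag, hφ₁, hd']
  by_cases hib : i = b
  · subst hib
    rw [Finset.sum_eq_zero]
    · simp [hd', hφ₂]
    · intro j hj
      obtain ⟨hja, hjb⟩ := (Finset.mem_filter.mp hj).2
      simp [hψb j hja hjb]
  · rw [Finset.sum_eq_single_of_mem i (by simp [hia, hib])]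
    · simp [hψdiag i hia hib]
    · intro j hj hji
      obtain ⟨hja, hjb⟩ := (Finset.mem_filter.mp hj).2
      simp [hψzero i j hja hjb hia hib hji.symm]
end

section
/- Shortening Lemma, ψ' is a chain map: with the data below, the family ψ' intertwines the reduced maps d' and d; precisely, for every i ∈ ι \ {a, b} and every k ∈ ι, one has ∑_{j ∈ ι} (ψ' i j) ∘ (d j k) = ∑_{j ∈ ι \ {a,b}} (d' i j) ∘ (ψ' j k). -/
/-- Shortening Lemma, `ψ'` is a chain map: the family `ψ'` intertwines the
reduced maps `d'` and `d`. -/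
theorem shortening_lemma_psi'_chain_map
    {A : Type*} [Ring A] {ℓ : A} (hℓ : ℓ ∈ Set.center A)
    {ι : Type*} [Fintype ι] [DecidableEq ι]
    {P : ι → Type*} [∀ i, AddCommGroup (P i)] [∀ i, Module A (P i)]
    (d : ∀ i j, P j →ₗ[A] P i)
    (hdiag : ∀ i, d i i = 0)
    (hoff : ∀ i j, i ≠ j → ∀ x : P j, ∑ k, d i k (d k j x) = 0)
    (hsq : ∀ i (x : P i), ∑ k, d i k (d k i x) = ℓ • x)
    (a b : ι) (hab : a ≠ b)
    (φinv : P b →ₗ[A] P a)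
    (hφ₁ : ∀ x : P a, φinv (d b a x) = x)
    (hφ₂ : ∀ y : P b, d b a (φinv y) = y)
    (d' : ∀ i j, P j →ₗ[A] P i)
    (hd' : ∀ i j, d' i j = d i j - (d i a) ∘ₗ φinv ∘ₗ (d b j))
    (ψ' : ∀ i j, P j →ₗ[A] P i)
    (hψ'diag : ∀ i, i ≠ a → i ≠ b → ψ' i i = LinearMap.id)
    (hψ'zero : ∀ i j, i ≠ a → i ≠ b → j ≠ a → j ≠ b → j ≠ i → ψ' i j = 0)
    (hψ'a : ∀ i, i ≠ a → i ≠ b → ψ' i a = 0)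
    (hψ'b : ∀ i, i ≠ a → i ≠ b → ψ' i b = -((d i a) ∘ₗ φinv)) :
    ∀ i, i ≠ a → i ≠ b → ∀ k, ∀ x : P k,
      ∑ j, ψ' i j (d j k x) =
        ∑ j ∈ Finset.univ.filter (fun j => j ≠ a ∧ j ≠ b), d' i j (ψ' j k x) := by
  intro i hia hib k x
  have hleft : ∑ j, ψ' i j (d j k x) = d i k x - d i a (φinv (d b k x)) := by
    rw [Fintype.sum_eq_add i b hib fun j hj => ?_]
    · simp [hψ'diag i hia hib, hψ'b i hia hib, sub_eq_add_neg]
    · by_cases hja : j = a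
      · subst hja
        simp [hψ'a i hia hib]
      · simp [hψ'zero i j hia hib hja hj.2 hj.1]
  rw [hleft]
  by_cases hka : k = a
  · subst hka
    rw [hφ₁, sub_self, Finset.sum_eq_zero]
    intro j hj
    obtain ⟨hja, hjb⟩ := (Finset.mem_filter.1 hj).2
    simp [hψ'a j hja hjb]
  by_cases hkb : k = b
  · subst hkb
    have hright : ∑ j ∈ Finset.univ.filter (fun j => j ≠ a ∧ j ≠ k), d' i j (ψ' j k x) =
        -∑ j ∈ Finset.univ.filter (fun j => j ≠ a ∧ j ≠ k), d' i j (d j a (φinv x)) := by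
      rw [← Finset.sum_neg_distrib]
      refine Finset.sum_congr rfl fun j hj => ?_
      obtain ⟨hja, hjk⟩ := (Finset.mem_filter.1 hj).2
      simp [hψ'b j hja hjk]
    have htotal : ∑ j, d' i j (d j a (φinv x)) = 0 := by
      simp only [hd', LinearMap.sub_apply, LinearMap.comp_apply, Finset.sum_sub_distrib,
        ← map_sum, hoff i a hia, hoff k a hab.symm, map_zero, sub_zero]
    have hpair : ∑ j ∈ Finset.univ.filter (fun j => ¬(j ≠ a ∧ j ≠ k)),
        d' i j (d j a (φinv x)) = d i k x := by
      have hset : Finset.univ.filter (fun j => ¬(j ≠ a ∧ j ≠ k)) = {a, k} := by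
        ext j
        simp only [Finset.mem_filter, Finset.mem_univ, true_and, Finset.mem_insert,
          Finset.mem_singleton]
        tauto
      rw [hset, Finset.sum_pair hab]
      simp [hdiag, hφ₂, hd']
    rw [← Finset.sum_filter_add_sum_filter_not Finset.univ (fun j => j ≠ a ∧ j ≠ k), hpair]
      at htotal
    rw [hright, neg_eq_of_add_eq_zero_right htotal]
    simp [hdiag]
  · rw [Finset.sum_eq_single_of_mem k (by simp [hka, hkb])]
    · simp [hψ'diag k hka hkb, hd']
    · intro j hj hjk
      obtain ⟨hja, hjb⟩ := (Finset.mem_filter.1 hj).2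
      simp [hψ'zero j k hja hjb hka hkb hjk.symm]
end

section
/- Shortening Lemma, explicit homotopy: with the data below, ψ ∘ ψ' is homotopic to the identity via the homotopy h whose only nonzero component is h a b = φ⁻¹ : P b → P a; precisely, for all i, k ∈ ι, (δ_{ik} id_{P i}) − ∑_{j ∈ ι \ {a,b}} (ψ i j) ∘ (ψ' j k) = ∑_{j ∈ ι} ((d i j) ∘ (h j k) + (h i j) ∘ (d j k)), where δ_{ik} id is the identity if i = k and 0 otherwise, and h j k = φ⁻¹ if (j,k) = (a,b) and h j k = 0 otherwise. In particular (P, d) and the reduced factorization (P restricted to ι \ {a,b}, d') are homotopy equivalent, hence quasi-isomorphic. -/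
/-- Shortening Lemma, explicit homotopy: `ψ ∘ ψ'` is homotopic to the identity
via the homotopy `h` whose only nonzero component is `h a b = φ⁻¹`. -/
theorem shortening_lemma_homotopy
    {A : Type*} [Ring A] {ℓ : A} (hℓ : ℓ ∈ Set.center A)
    {ι : Type*} [Fintype ι] [DecidableEq ι]
    {P : ι → Type*} [∀ i, AddCommGroup (P i)] [∀ i, Module A (P i)]
    (d : ∀ i j, P j →ₗ[A] P i)
    (hdiag : ∀ i, d i i = 0)
    (hoff : ∀ i j, i ≠ j → ∀ x : P j, ∑ k, d i k (d k j x) = 0)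
    (hsq : ∀ i (x : P i), ∑ k, d i k (d k i x) = ℓ • x)
    (a b : ι) (hab : a ≠ b)
    (φinv : P b →ₗ[A] P a)
    (hφ₁ : ∀ x : P a, φinv (d b a x) = x)
    (hφ₂ : ∀ y : P b, d b a (φinv y) = y)
    (ψ : ∀ j k, P k →ₗ[A] P j)
    (hψdiag : ∀ k, k ≠ a → k ≠ b → ψ k k = LinearMap.id)
    (hψzero : ∀ j k, k ≠ a → k ≠ b → j ≠ a → j ≠ b → j ≠ k → ψ j k = 0)
    (hψa : ∀ k, k ≠ a → k ≠ b → ψ a k = -(φinv ∘ₗ d b k))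
    (hψb : ∀ k, k ≠ a → k ≠ b → ψ b k = 0)
    (ψ' : ∀ i j, P j →ₗ[A] P i)
    (hψ'diag : ∀ i, i ≠ a → i ≠ b → ψ' i i = LinearMap.id)
    (hψ'zero : ∀ i j, i ≠ a → i ≠ b → j ≠ a → j ≠ b → j ≠ i → ψ' i j = 0)
    (hψ'a : ∀ i, i ≠ a → i ≠ b → ψ' i a = 0)
    (hψ'b : ∀ i, i ≠ a → i ≠ b → ψ' i b = -((d i a) ∘ₗ φinv))
    (h : ∀ j k, P k →ₗ[A] P j)
    (hhab : h a b = φinv)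
    (hhzero : ∀ j k, ¬(j = a ∧ k = b) → h j k = 0) :
    (∀ i (x : P i),
        x - ∑ j ∈ Finset.univ.filter (fun j => j ≠ a ∧ j ≠ b), ψ i j (ψ' j i x) =
          ∑ j, (d i j (h j i x) + h i j (d j i x))) ∧
    (∀ i k, i ≠ k → ∀ x : P k,
        -(∑ j ∈ Finset.univ.filter (fun j => j ≠ a ∧ j ≠ b), ψ i j (ψ' j k x)) =
          ∑ j, (d i j (h j k x) + h i j (d j k x))) := by
  have hR : ∀ i k (x : P k), ∑ j, (d i j (h j k x) + h i j (d j k x)) =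
      d i a (h a k x) + h i b (d b k x) := by
    intro i k x
    rw [Finset.sum_add_distrib]
    congr 1
    · refine Finset.sum_eq_single a (fun j _ hj => ?_) (by simp)
      simp [hhzero j k (by tauto)]
    · refine Finset.sum_eq_single b (fun j _ hj => ?_) (by simp)
      simp [hhzero i j (by tauto)]
  have hcol : ∀ i k, k ≠ a → k ≠ b → ∀ x : P k,
      ∑ j ∈ Finset.univ.filter (fun j => j ≠ a ∧ j ≠ b), ψ i j (ψ' j k x) = ψ i k x := by
    intro i k hka hkb x
    rw [Finset.sum_eq_single_of_mem k (by simp [hka, hkb])]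
    · simp [hψ'diag k hka hkb]
    · intro j hj hjk
      obtain ⟨hja, hjb⟩ := (Finset.mem_filter.mp hj).2
      simp [hψ'zero j k hja hjb hka hkb hjk.symm]
  have hrow : ∀ i k, i ≠ a → i ≠ b → ∀ x : P k,
      ∑ j ∈ Finset.univ.filter (fun j => j ≠ a ∧ j ≠ b), ψ i j (ψ' j k x) = ψ' i k x := by
    intro i k hia hib x
    rw [Finset.sum_eq_single_of_mem i (by simp [hia, hib])]
    · simp [hψdiag i hia hib]
    · intro j hj hji
      obtain ⟨hja, hjb⟩ := (Finset.mem_filter.mp hj).2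
      simp [hψzero i j hja hjb hia hib hji.symm]
  have hcola : ∀ i (x : P a),
      ∑ j ∈ Finset.univ.filter (fun j => j ≠ a ∧ j ≠ b), ψ i j (ψ' j a x) = 0 := by
    intro i x
    refine Finset.sum_eq_zero fun j hj => ?_
    obtain ⟨hja, hjb⟩ := (Finset.mem_filter.mp hj).2
    simp [hψ'a j hja hjb]
  have hrowb : ∀ k (x : P k),
      ∑ j ∈ Finset.univ.filter (fun j => j ≠ a ∧ j ≠ b), ψ b j (ψ' j k x) = 0 := by
    intro k x
    refine Finset.sum_eq_zero fun j hj => ?_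
    obtain ⟨hja, hjb⟩ := (Finset.mem_filter.mp hj).2
    simp [hψb j hja hjb]
  have hcorner : ∀ x : P b,
      ∑ j ∈ Finset.univ.filter (fun j => j ≠ a ∧ j ≠ b), ψ a j (ψ' j b x) = 0 := by
    intro x
    calc ∑ j ∈ Finset.univ.filter (fun j => j ≠ a ∧ j ≠ b), ψ a j (ψ' j b x)
        = ∑ j ∈ Finset.univ.filter (fun j => j ≠ a ∧ j ≠ b),
            φinv (d b j (d j a (φinv x))) := by
          refine Finset.sum_congr rfl fun j hj => ?_
          obtain ⟨hja, hjb⟩ := (Finset.mem_filter.mp hj).2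
          simp [hψa j hja hjb, hψ'b j hja hjb]
      _ = ∑ j, φinv (d b j (d j a (φinv x))) := by
          refine Finset.sum_subset (Finset.filter_subset _ _) fun j _ hj => ?_
          obtain rfl | rfl : j = a ∨ j = b := by
            by_contra! hne
            exact hj (by simp [hne])
          · simp [hdiag j]
          · simp [hdiag j]
      _ = 0 := by rw [← map_sum, hoff b a hab.symm, map_zero]
  refine ⟨fun i x => ?_, fun i k hik x => ?_⟩
  · rw [hR]
    by_cases hia : i = a
    · subst hia
      rw [hcola, hhab, hφ₁, hhzero i i (by tauto)]
      simp
    by_cases hib : i = b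
    · subst hib
      rw [hrowb, hhab, hφ₂, hhzero i i (by tauto)]
      simp
    rw [hcol i i hia hib, hψdiag i hia hib, hhzero a i (by tauto), hhzero i b (by tauto)]
    simp
  · rw [hR]
    by_cases hka : k = a
    · subst hka
      rw [hcola, hhzero k k (by tauto), hhzero i b (by tauto)]
      simp
    by_cases hib : i = b
    · subst hib
      rw [hrowb, hhzero a k (by tauto), hhzero i i (by tauto)]
      simp
    by_cases hkb : k = b
    · subst hkb
      by_cases hia : i = a
      · subst hia
        rw [hcorner]
        simp [hdiag]
      · rw [hrow i k hia hib, hψ'b i hia hib, hhab, hdiag k]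
        simp
    rw [hcol i k hka hkb, hhzero a k (by tauto)]
    by_cases hia : i = a
    · subst hia
      rw [hψa k hka hkb, hhab]
      simp
    · rw [hψzero i k hka hkb hia hib hik, hhzero i b (by tauto)]
      simp
end
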